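/- Strong duality for the perturbed distance function: for every γ ≥ 0, every P ∈ 𝒫, and every deceitful arm x′ ∈ X̃_d(P), Dist_γ(η,x′,P) = sup { Dual_γ(η,x′,P;μ) : μ = (α,β,λ) ∈ ℝ_+ × ℝ × 𝒦* }. -/

import Mathlib

open scoped BigOperators Classical
open Filter

namespace Bandit

/-- Matrices indexed by rewards and arms; a reward distribution is such a matrix. -/
abbrev RMat (R X : Type*) := R → X → ℝ

section Core

variable {R X : Type*} [Fintype R] [Fintype X] [Nonempty X]

/-- The set `𝒫_Ω` of all reward distributions. -/
def POmega : Set (RMat R X) :=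
  {Q | (∀ r x, 0 ≤ Q r x) ∧ ∀ x : X, ∑ r : R, Q r x = 1}

/-- The interior of `T` in the topology relative to `S`. -/
def relIntIn (S T : Set (RMat R X)) : Set (RMat R X) :=
  {Q | Q ∈ T ∧ ∃ U : Set (RMat R X), IsOpen U ∧ Q ∈ U ∧ U ∩ S ⊆ T}

/-- Information distance `I(M', M)` between two nonnegative measures on a finite set. -/
noncomputable def infoDiv {α : Type*} [Fintype α] (M' M : α → ℝ) : EReal :=
  if ∀ a, M a = 0 → M' a = 0 then
    ((∑ a : α, (M' a * Real.log (M' a / M a) - M' a + M a) : ℝ) : EReal)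
  else ⊤

/-- Expected reward of arm `x` under reward distribution `Q` (reward values `v`). -/
def rewOf (v : R → ℝ) (Q : RMat R X) (x : X) : ℝ := ∑ r : R, v r * Q r x

/-- Optimal expected reward `Rew*`. -/
noncomputable def rewStar (v : R → ℝ) (Q : RMat R X) : ℝ :=
  Finset.univ.sup' Finset.univ_nonempty (rewOf v Q)

/-- The set `x*(Q)` of optimal arms. -/
def optArms (v : R → ℝ) (Q : RMat R X) : Set X := {x | rewOf v Q x = rewStar v Q}

/-- The set `X̃(Q)` of suboptimal arms. -/
def subArms (v : R → ℝ) (Q : RMat R X) : Set X := {x | rewOf v Q x ≠ rewStar v Q}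

noncomputable def optFinset (v : R → ℝ) (Q : RMat R X) : Finset X :=
  Finset.univ.filter fun x => rewOf v Q x = rewStar v Q

noncomputable def subFinset (v : R → ℝ) (Q : RMat R X) : Finset X :=
  Finset.univ.filter fun x => rewOf v Q x ≠ rewStar v Q

/-- The suboptimality gap `Δ(x, Q)`. -/
noncomputable def gapOf (v : R → ℝ) (Q : RMat R X) (x : X) : ℝ := rewStar v Q - rewOf v Q x

/-- The set `Deceit(x', P)` of deceitful reward distributions. -/
def DeceitSet (v : R → ℝ) (PP : Set (RMat R X)) (x' : X) (P : RMat R X) :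
    Set (RMat R X) :=
  {Q | Q ∈ PP ∧ (∀ x ∈ optArms v P, ∀ r, Q r x = P r x) ∧
    ∀ x ∈ optArms v P, rewOf v Q x < rewOf v Q x'}

/-- The objective `Σ_{x ∈ X̃(P)} η(x)·I(P(x), Q(x))`. -/
noncomputable def distObj (v : R → ℝ) (η : X → ℝ) (P Q : RMat R X) : EReal :=
  ∑ x ∈ subFinset v P, ((η x : ℝ) : EReal) * infoDiv (fun r => P r x) (fun r => Q r x)

/-- The distance function `Dist(η, x', P)` (equal to `⊤` if `Deceit(x', P)` is empty). -/
noncomputable def DistFn (v : R → ℝ) (PP : Set (RMat R X)) (η : X → ℝ) (x' : X)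
    (P : RMat R X) : EReal :=
  sInf (distObj v η P '' DeceitSet v PP x' P)

/-- The regret lower bound `C(P)`. -/
noncomputable def CFn (v : R → ℝ) (PP : Set (RMat R X)) (P : RMat R X) : EReal :=
  sInf {c : EReal | ∃ η : X → ℝ, (∀ x, 0 ≤ η x) ∧
    (∀ x ∈ subArms v P, 1 ≤ DistFn v PP η x P) ∧
    c = ((∑ x ∈ subFinset v P, η x * gapOf v P x : ℝ) : EReal)}

/-- The maximal reward `Rew_max(x', P)` of arm `x'`. -/
noncomputable def rewMax (v : R → ℝ) (PP : Set (RMat R X)) (x' : X) (P : RMat R X) : ℝ :=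
  sSup {c : ℝ | ∃ Q ∈ PP, (∀ x ∈ optArms v P, ∀ r, Q r x = P r x) ∧ c = rewOf v Q x'}

/-- The set `X̃_d(P)` of deceitful arms. -/
def deceitArms (v : R → ℝ) (PP : Set (RMat R X)) (P : RMat R X) : Set X :=
  {x | x ∈ subArms v P ∧ rewStar v P < rewMax v PP x P}

/-- The conic hull `𝒦 = cone(𝒫)`. -/
def coneP (PP : Set (RMat R X)) : Set (RMat R X) :=
  {Q | ∃ θ : ℝ, 0 ≤ θ ∧ ∃ Q' ∈ PP, Q = θ • Q'}

/-- The dual cone `𝒦*`. -/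
def dualConeP (PP : Set (RMat R X)) : Set (RMat R X) :=
  {l | ∀ Q ∈ coneP PP, 0 ≤ ∑ x : X, ∑ r : R, l r x * Q r x}

/-- Extended-real logarithm (with `elog t = ⊥` for `t ≤ 0`). -/
noncomputable def elog (t : ℝ) : EReal := if 0 < t then ((Real.log t : ℝ) : EReal) else ⊥

/-- The dual function `Dual(η, x', Q; μ)` for `μ = (α, β, λ)`. -/
noncomputable def dualFn (v : R → ℝ) (η : X → ℝ) (x' : X) (Q : RMat R X)
    (α β : ℝ) (l : RMat R X) : EReal :=
  if ∀ x ∈ subFinset v Q, ∀ r : R,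
      0 ≤ η x - l r x - β - α * v r * (if x = x' then 1 else 0) then
    (∑ x ∈ subFinset v Q, ∑ r : R,
      ((η x * Q r x : ℝ) : EReal) *
        elog ((η x - l r x - β - α * v r * (if x = x' then 1 else 0)) / η x)) +
    ((-(∑ x ∈ optFinset v Q, ∑ r : R, l r x * Q r x) + α * rewStar v Q +
        β * ((subFinset v Q).card : ℝ) : ℝ) : EReal)
  else ⊥

/-- The set `𝒫'` of reward distributions satisfying Assumption 1. -/
def PPrime (v : R → ℝ) (PP : Set (RMat R X)) : Set (RMat R X) :=
  {P | P ∈ PP ∧ (∃ x₀ : X, optArms v P = {x₀}) ∧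
    (∀ x : X, rewMax v PP x P ≠ rewStar v P) ∧ P ∈ relIntIn POmega PP}

/-- The dual-test function `Dualbar(η, x', Q; μ) = max_{ρ ≥ 0} Dual(η, x', Q; ρ·μ)`. -/
noncomputable def dualTest (v : R → ℝ) (η : X → ℝ) (x' : X) (Q : RMat R X)
    (μ : ℝ × ℝ × RMat R X) : EReal :=
  sSup {d : EReal | ∃ ρ : ℝ, 0 ≤ ρ ∧ d = dualFn v η x' Q (ρ * μ.1) (ρ * μ.2.1) (ρ • μ.2.2)}

end Core

end Bandit

namespace Bandit

variable {R X : Type*} [Fintype R] [Fintype X] [Nonempty X]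

/-- Perturbed objective `Σ_{x∈X̃(P)} η(x) I(P(x),Q(x)) + γ I(P(x*(P)), Q(x*(P)))`. -/
noncomputable def distObjPert (v : R → ℝ) (γ : ℝ) (η : X → ℝ) (P Q : RMat R X) : EReal :=
  distObj v η P Q +
    ∑ x ∈ optFinset v P, ((γ : ℝ) : EReal) * infoDiv (fun r => P r x) (fun r => Q r x)

/-- The perturbed distance function `Dist_γ(η, x', P)`: the infimum of the perturbed
objective over `Q ∈ 𝒦` with `Σ_{x,r} Q(r,x) = |X|` and `Σ_r r·Q(r,x') ≥ Rew*(P)`. -/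
noncomputable def DistPert (v : R → ℝ) (PP : Set (RMat R X)) (γ : ℝ) (η : X → ℝ)
    (x' : X) (P : RMat R X) : EReal :=
  sInf (distObjPert v γ η P ''
    {Q | Q ∈ coneP PP ∧ (∑ x : X, ∑ r : R, Q r x) = (Fintype.card X : ℝ) ∧
      rewStar v P ≤ rewOf v Q x'})

/-- The perturbed dual function `Dual_γ(η, x', P; μ)` for `μ = (α, β, λ)`. -/
noncomputable def dualFnPert (v : R → ℝ) (γ : ℝ) (η : X → ℝ) (x' : X) (P : RMat R X)
    (α β : ℝ) (l : RMat R X) : EReal :=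
  if (∀ x ∈ subFinset v P, ∀ r : R,
        0 ≤ η x - l r x - β - α * v r * (if x = x' then 1 else 0)) ∧
     (∀ x ∈ optFinset v P, ∀ r : R, 0 ≤ γ - l r x - β) then
    (∑ x ∈ subFinset v P, ∑ r : R,
      ((η x * P r x : ℝ) : EReal) *
        elog ((η x - l r x - β - α * v r * (if x = x' then 1 else 0)) / η x)) +
    (∑ x ∈ optFinset v P, ∑ r : R,
      ((γ * P r x : ℝ) : EReal) * elog ((γ - l r x - β) / γ)) +
    ((α * rewStar v P + β * (Fintype.card X : ℝ) : ℝ) : EReal)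
  else ⊥

section RealEstimates

/-- The contribution of a single pair of masses to the information distance. -/
noncomputable def klTerm (p q : ℝ) : ℝ := p * Real.log (p / q) - p + q

lemma klTerm_nonneg {p q : ℝ} (hp : 0 ≤ p) (hq : 0 ≤ q) (h : q = 0 → p = 0) :
    0 ≤ klTerm p q := by
  unfold klTerm
  rcases hp.eq_or_lt with rfl | hp
  · simpa using hq
  have hq' : 0 < q := hq.lt_of_ne fun h0 => hp.ne' (h h0.symm)
  have hlog := Real.one_sub_inv_le_log_of_pos (div_pos hp hq')
  have hmul := mul_le_mul_of_nonneg_left hlog hp.le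
  have : p * (1 - (p / q)⁻¹) = p - q := by field_simp
  linarith

lemma klTerm_sub_le {p q q' : ℝ} (hp : 0 ≤ p) (hq : 0 < q) (hq' : 0 < q') :
    klTerm p q' - klTerm p q ≤ (q' - q) * (1 - p / q') := by
  unfold klTerm
  rcases hp.eq_or_lt with rfl | hp
  · simp
  have hlog := Real.log_le_sub_one_of_pos (div_pos hq hq')
  have hmul := mul_le_mul_of_nonneg_left hlog hp.le
  rw [Real.log_div hq.ne' hq'.ne'] at hmul
  rw [Real.log_div hp.ne' hq'.ne', Real.log_div hp.ne' hq.ne']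
  have : p * (q / q' - 1) + (q' - q) = (q' - q) * (1 - p / q') := by field_simp; ring
  linarith

/-- A sublevel bound on the information distance keeps the second mass away from `0`. -/
lemma mul_exp_le_of_klTerm_le {w p q C : ℝ} (hwp : 0 < w * p) (hp : 0 < p) (hq : 0 < q)
    (hw : 0 ≤ w) (h : w * klTerm p q ≤ C) : p * Real.exp (-(C / (w * p) + 1)) ≤ q := by
  have hlog : Real.log (p / q) ≤ C / (w * p) + 1 := by
    rw [← sub_le_iff_le_add, le_div_iff₀ hwp]
    unfold klTerm at h
    nlinarith [mul_nonneg hw hq.le]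
  rw [Real.log_le_iff_le_exp (div_pos hp hq), div_le_iff₀ hq] at hlog
  rw [Real.exp_neg, ← div_eq_mul_inv, div_le_iff₀ (Real.exp_pos _)]
  linarith

lemma mul_elog_le {w p q u : ℝ} (hw : 0 ≤ w) (hp : 0 ≤ p) (hq : 0 ≤ q) (hu : 0 ≤ u)
    (hpq : w * p ≠ 0 → q ≠ 0) :
    ((w * p : ℝ) : EReal) * elog (u / w) ≤ ((w * klTerm p q - (w - u) * q : ℝ) : EReal) := by
  have huq := mul_nonneg hu hq
  by_cases hwp : w * p = 0
  · rw [hwp, EReal.coe_zero, zero_mul, ← EReal.coe_zero, EReal.coe_le_coe_iff]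
    have : w * klTerm p q - (w - u) * q = w * p * Real.log (p / q) - w * p + u * q := by
      unfold klTerm; ring
    rw [this, hwp]
    linarith
  have hw' : 0 < w := hw.lt_of_ne fun h => hwp (by simp [← h])
  have hp' : 0 < p := hp.lt_of_ne fun h => hwp (by simp [← h])
  have hq' : 0 < q := hq.lt_of_ne' (hpq hwp)
  have hwp' : 0 < w * p := mul_pos hw' hp'
  rcases hu.eq_or_lt with rfl | hu'
  · simp [elog, EReal.coe_mul_bot_of_pos hwp', -EReal.coe_mul]
  rw [elog, if_pos (div_pos hu' hw'), ← EReal.coe_mul, EReal.coe_le_coe_iff]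
  have hlog := Real.log_le_sub_one_of_pos (div_pos (div_pos hu' hw') (div_pos hp' hq'))
  have hmul := mul_le_mul_of_nonneg_left hlog hwp'.le
  rw [Real.log_div (div_pos hu' hw').ne' (div_pos hp' hq').ne'] at hmul
  have : w * p * (u / w / (p / q) - 1) = u * q - w * p := by field_simp
  unfold klTerm
  linarith

lemma coe_finsetSum {ι : Type*} (s : Finset ι) (f : ι → ℝ) :
    ((∑ i ∈ s, f i : ℝ) : EReal) = ∑ i ∈ s, (f i : EReal) :=
  map_sum (⟨⟨Real.toEReal, rfl⟩, EReal.coe_add⟩ : ℝ →+ EReal) f s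

/-- Existence of a Lagrange multiplier for one concave constraint under Slater's condition. -/
lemma exists_lagrange_multiplier {E : Type*} [AddCommGroup E] [Module ℝ E] {S : Set E}
    {G H : E → ℝ} (hG : ConvexOn ℝ S G) (hH : ConcaveOn ℝ S H)
    (hGH : ∀ x ∈ S, 0 ≤ H x → 0 ≤ G x) {x₀ : E} (hx₀ : x₀ ∈ S) (hH₀ : 0 < H x₀) :
    ∃ α : ℝ, 0 ≤ α ∧ ∀ x ∈ S, α * H x ≤ G x := by
  set A : Set ℝ := (fun x => G x / H x) '' {x ∈ S | 0 < H x} with hA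
  have hA₀ : A.Nonempty := ⟨_, x₀, ⟨hx₀, hH₀⟩, rfl⟩
  have hpos : ∀ a ∈ A, 0 ≤ a := by
    rintro _ ⟨x, ⟨hx, hHx⟩, rfl⟩
    exact div_nonneg (hGH x hx hHx.le) hHx.le
  refine ⟨sInf A, Real.sInf_nonneg hpos, fun x hx => ?_⟩
  rcases lt_trichotomy (H x) 0 with hneg | hzero | hHx
  · have : G x / H x ≤ sInf A := by
      refine le_csInf hA₀ ?_
      rintro _ ⟨y, ⟨hy, hHy⟩, rfl⟩
      have hd : 0 < H y - H x := by linarith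
      have ha : 0 ≤ H y / (H y - H x) := by positivity
      have hb : 0 ≤ -H x / (H y - H x) := div_nonneg (by linarith) hd.le
      have hab : H y / (H y - H x) + -H x / (H y - H x) = 1 := by field_simp; ring
      have hHz := hH.2 hx hy ha hb hab
      have hGz := hG.2 hx hy ha hb hab
      simp only [smul_eq_mul] at hHz hGz
      have h0 : H y / (H y - H x) * H x + -H x / (H y - H x) * H y = 0 := by field_simp; ring
      have hG0 := hGH _ (hG.1 hx hy ha hb hab) (by linarith)
      have h1 : 0 ≤ (H y * G x - H x * G y) / (H y - H x) := by
        have : (H y * G x - H x * G y) / (H y - H x) =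
          H y / (H y - H x) * G x + -H x / (H y - H x) * G y := by ring
        linarith
      rw [le_div_iff₀ hd, zero_mul] at h1
      rw [div_le_iff_of_neg hneg, div_mul_eq_mul_div, div_le_iff₀ hHy]
      linarith
    rwa [div_le_iff_of_neg hneg] at this
  · simpa [hzero] using hGH x hx hzero.ge
  · rw [← le_div_iff₀ hHx]
    exact csInf_le ⟨0, hpos⟩ ⟨x, ⟨hx, hHx⟩, rfl⟩

end RealEstimates

section WeightedDivergence

variable {R X : Type*}

/-- `Q` is positive wherever the weighted `P` is, so that the weighted distance is finite. -/
def Dominates (w : X → ℝ) (P Q : RMat R X) : Prop :=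
  ∀ x r, w x * P r x ≠ 0 → Q r x ≠ 0

lemma term_nonneg {w : X → ℝ} (hw : ∀ x, 0 ≤ w x) {P Q : RMat R X} (hP : ∀ r x, 0 ≤ P r x)
    (hQ : ∀ r x, 0 ≤ Q r x) (hdom : Dominates w P Q) (x : X) (r : R) :
    0 ≤ w x * klTerm (P r x) (Q r x) := by
  rcases eq_or_ne (w x) 0 with h | h
  · simp [h]
  refine mul_nonneg (hw x) (klTerm_nonneg (hP r x) (hQ r x) fun h0 => ?_)
  by_contra hp
  exact hdom x r (mul_ne_zero h hp) h0

/-- The gradient in the second argument of the weighted information distance. -/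
noncomputable def divGrad (w : X → ℝ) (P Q : RMat R X) : RMat R X :=
  fun r x => w x - w x * P r x / Q r x

variable [Fintype R] [Fintype X]

/-- The real-valued weighted information distance. -/
noncomputable def weightedDiv (w : X → ℝ) (P Q : RMat R X) : ℝ :=
  ∑ x, w x * ∑ r, klTerm (P r x) (Q r x)

/-- The bilinear pairing of matrices, as a linear map in the second argument. -/
def pairing (l : RMat R X) : RMat R X →ₗ[ℝ] ℝ where
  toFun Q := ∑ x, ∑ r, l r x * Q r x
  map_add' Q Q' := by simp [mul_add, Finset.sum_add_distrib]
  map_smul' c Q := by simp [Finset.mul_sum, mul_left_comm]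

lemma pairing_apply (l Q : RMat R X) : pairing l Q = ∑ x, ∑ r, l r x * Q r x := rfl

lemma term_le_weightedDiv {w : X → ℝ} (hw : ∀ x, 0 ≤ w x) {P Q : RMat R X}
    (hP : ∀ r x, 0 ≤ P r x) (hQ : ∀ r x, 0 ≤ Q r x) (hdom : Dominates w P Q) (x : X) (r : R) :
    w x * klTerm (P r x) (Q r x) ≤ weightedDiv w P Q := by
  have hterm := term_nonneg hw hP hQ hdom
  simp only [weightedDiv, Finset.mul_sum]
  calc _ ≤ ∑ r, w x * klTerm (P r x) (Q r x) :=
        Finset.single_le_sum (f := fun r => w x * klTerm (P r x) (Q r x))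
          (fun r _ => hterm x r) (Finset.mem_univ r)
    _ ≤ _ := Finset.single_le_sum (f := fun x => ∑ r, w x * klTerm (P r x) (Q r x))
          (fun x _ => Finset.sum_nonneg fun r _ => hterm x r) (Finset.mem_univ x)

lemma continuousOn_weightedDiv (w : X → ℝ) (P : RMat R X) :
    ContinuousOn (weightedDiv w P) {Q | Dominates w P Q} := by
  unfold weightedDiv
  simp only [Finset.mul_sum]
  refine continuousOn_finsetSum _ fun x _ => continuousOn_finsetSum _ fun r _ => ?_
  have hcoord : Continuous fun Q : RMat R X => Q r x := by fun_prop
  by_cases h : w x * P r x = 0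
  · have : (fun Q : RMat R X => w x * klTerm (P r x) (Q r x)) = fun Q => w x * Q r x := by
      funext Q
      have : w x * klTerm (P r x) (Q r x) =
        w x * P r x * Real.log (P r x / Q r x) - w x * P r x + w x * Q r x := by
        unfold klTerm; ring
      rw [this, h]; ring
    rw [this]
    exact (continuous_const.mul hcoord).continuousOn
  · have hp : P r x ≠ 0 := right_ne_zero_of_mul h
    unfold klTerm
    have hne : ∀ Q ∈ {Q | Dominates w P Q}, Q r x ≠ 0 := fun Q hQ => hQ x r h
    have hlog : ContinuousOn (fun Q : RMat R X => Real.log (P r x / Q r x))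
        {Q | Dominates w P Q} :=
      (continuousOn_const.div hcoord.continuousOn hne).log fun Q hQ => div_ne_zero hp (hne Q hQ)
    exact continuousOn_const.mul (((continuousOn_const.mul hlog).sub continuousOn_const).add
      hcoord.continuousOn)

/-- The weighted information distance attains its minimum on a compact set. -/
lemma exists_isMin_weightedDiv {S : Set (RMat R X)} (hS : IsCompact S)
    (hS₀ : ∀ Q ∈ S, ∀ r x, 0 ≤ Q r x) {w : X → ℝ} (hw : ∀ x, 0 ≤ w x) {P : RMat R X}
    (hP : ∀ r x, 0 ≤ P r x) {Q₀ : RMat R X} (hQ₀ : Q₀ ∈ S) (hdom₀ : Dominates w P Q₀) :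
    ∃ Q' ∈ S, Dominates w P Q' ∧
      ∀ Q ∈ S, Dominates w P Q → weightedDiv w P Q' ≤ weightedDiv w P Q := by
  set δ : RMat R X := fun r x =>
    P r x * Real.exp (-(weightedDiv w P Q₀ / (w x * P r x) + 1)) with hδ
  set T : Set (RMat R X) := S ∩ {Q | ∀ x r, w x * P r x ≠ 0 → δ r x ≤ Q r x} with hT
  have hclosed : IsClosed {Q : RMat R X | ∀ x r, w x * P r x ≠ 0 → δ r x ≤ Q r x} := by
    simp only [Set.ofPred_forall]
    exact isClosed_iInter fun x => isClosed_iInter fun r => isClosed_iInter fun _ =>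
      isClosed_le continuous_const (by fun_prop)
  have hTdom : T ⊆ {Q | Dominates w P Q} := fun Q hQ x r h => by
    have hpos : 0 < δ r x :=
      mul_pos ((hP r x).lt_of_ne' (right_ne_zero_of_mul h)) (Real.exp_pos _)
    exact (hpos.trans_le (hQ.2 x r h)).ne'
  have hsub : ∀ Q ∈ S, Dominates w P Q → weightedDiv w P Q ≤ weightedDiv w P Q₀ → Q ∈ T := by
    intro Q hQ hdom hle
    refine ⟨hQ, fun x r h => ?_⟩
    have hp := (hP r x).lt_of_ne' (right_ne_zero_of_mul h)
    have hwx := (hw x).lt_of_ne' (left_ne_zero_of_mul h)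
    exact mul_exp_le_of_klTerm_le (mul_pos hwx hp) hp ((hS₀ Q hQ r x).lt_of_ne' (hdom x r h))
      hwx.le ((term_le_weightedDiv hw hP (hS₀ Q hQ) hdom x r).trans hle)
  have hQ₀T := hsub Q₀ hQ₀ hdom₀ le_rfl
  obtain ⟨Q', hQ', hmin⟩ := (hS.inter_right hclosed).exists_isMinOn ⟨Q₀, hQ₀T⟩
    ((continuousOn_weightedDiv w P).mono hTdom)
  refine ⟨Q', hQ'.1, hTdom hQ', fun Q hQ hdom => ?_⟩
  rcases le_total (weightedDiv w P Q) (weightedDiv w P Q₀) with h | h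
  · exact hmin (hsub Q hQ hdom h)
  · exact (hmin hQ₀T).trans h

/-- First-order optimality condition at a minimizer over a convex set. -/
lemma pairing_divGrad_le_of_isMin {S : Set (RMat R X)} (hS : Convex ℝ S)
    (hS₀ : ∀ Q ∈ S, ∀ r x, 0 ≤ Q r x) {w : X → ℝ} (hw : ∀ x, 0 ≤ w x) {P : RMat R X}
    (hP : ∀ r x, 0 ≤ P r x) {Q' : RMat R X} (hQ' : Q' ∈ S) (hdom : Dominates w P Q')
    (hmin : ∀ Q ∈ S, Dominates w P Q → weightedDiv w P Q' ≤ weightedDiv w P Q)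
    {Q : RMat R X} (hQ : Q ∈ S) :
    pairing (divGrad w P Q') Q' ≤ pairing (divGrad w P Q') Q := by
  set h : ℝ → ℝ := fun t => ∑ x, ∑ r,
    (w x - w x * P r x / (Q' r x + t * (Q r x - Q' r x))) * (Q r x - Q' r x) with hh
  have hlim : Tendsto h (nhdsWithin 0 (Set.Ioi 0)) (nhds (h 0)) := by
    refine Tendsto.mono_left ?_ nhdsWithin_le_nhds
    refine tendsto_finsetSum _ fun x _ => tendsto_finsetSum _ fun r _ => ?_
    by_cases hwp : w x * P r x = 0
    · simp [hwp]
    · have hne : Q' r x + 0 * (Q r x - Q' r x) ≠ 0 := by simpa using hdom x r hwp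
      have hden : ContinuousAt (fun t : ℝ => Q' r x + t * (Q r x - Q' r x)) 0 := by fun_prop
      exact ((continuousAt_const.sub (continuousAt_const.div hden hne)).mul
        continuousAt_const).tendsto
  have hpos : ∀ᶠ t in nhdsWithin (0 : ℝ) (Set.Ioi 0), 0 ≤ h t := by
    filter_upwards [Ioo_mem_nhdsGT (zero_lt_one' ℝ)] with t ⟨ht0, ht1⟩
    set Qt : RMat R X := (1 - t) • Q' + t • Q with hQt
    have hQtS : Qt ∈ S := hS hQ' hQ (by linarith) ht0.le (by ring)
    have hval : ∀ r x, Qt r x = Q' r x + t * (Q r x - Q' r x) := fun r x => by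
      simp only [hQt, Pi.add_apply, Pi.smul_apply, smul_eq_mul]; ring
    have hQ'pos : ∀ x r, w x * P r x ≠ 0 → 0 < Q' r x := fun x r hwp =>
      (hS₀ Q' hQ' r x).lt_of_ne' (hdom x r hwp)
    have hQtpos : ∀ x r, w x * P r x ≠ 0 → 0 < Qt r x := fun x r hwp => by
      rw [hval]
      nlinarith [mul_pos (sub_pos.2 ht1) (hQ'pos x r hwp), mul_nonneg ht0.le (hS₀ Q hQ r x)]
    have hle := hmin Qt hQtS fun x r hwp => (hQtpos x r hwp).ne'
    have hdiff : weightedDiv w P Qt - weightedDiv w P Q' ≤ t * h t := by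
      simp only [weightedDiv, hh, Finset.mul_sum, ← Finset.sum_sub_distrib]
      refine Finset.sum_le_sum fun x _ => Finset.sum_le_sum fun r _ => ?_
      rw [← hval]
      have hd : t * (Q r x - Q' r x) = Qt r x - Q' r x := by rw [hval]; ring
      have hrhs : t * ((w x - w x * P r x / Qt r x) * (Q r x - Q' r x)) =
          w x * ((Qt r x - Q' r x) * (1 - P r x / Qt r x)) := by rw [← hd]; ring
      rw [hrhs, ← mul_sub]
      by_cases hwp : w x * P r x = 0
      · rcases mul_eq_zero.1 hwp with h0 | h0 <;> simp [h0, klTerm]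
      · exact mul_le_mul_of_nonneg_left
          (klTerm_sub_le (hP r x) (hQ'pos x r hwp) (hQtpos x r hwp)) (hw x)
    nlinarith
  have h0 := ge_of_tendsto hlim hpos
  have hpair : h 0 = pairing (divGrad w P Q') Q - pairing (divGrad w P Q') Q' := by
    simp [hh, pairing_apply, divGrad, mul_sub, Finset.sum_sub_distrib]
  linarith

end WeightedDivergence

section Duality

variable {R X : Type*} [Fintype R] [Fintype X]

/-- The information distance weighted by `w`, allowing infinite values. -/
lemma sum_mul_infoDiv_of_dominates {w : X → ℝ} {P Q : RMat R X} (hdom : Dominates w P Q) :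
    ∑ x, (w x : EReal) * infoDiv (fun r => P r x) (fun r => Q r x) =
      (weightedDiv w P Q : EReal) := by
  rw [weightedDiv, coe_finsetSum]
  refine Finset.sum_congr rfl fun x _ => ?_
  rcases eq_or_ne (w x) 0 with h | h
  · simp [h]
  have hac : ∀ r, Q r x = 0 → P r x = 0 := fun r h0 => by
    by_contra hp
    exact hdom x r (mul_ne_zero h hp) h0
  rw [infoDiv, if_pos hac, EReal.coe_mul]
  rfl

lemma sum_mul_infoDiv_of_not_dominates {w : X → ℝ} (hw : ∀ x, 0 ≤ w x) {P Q : RMat R X}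
    (hP : ∀ r x, 0 ≤ P r x) (hQ : ∀ r x, 0 ≤ Q r x) (hdom : ¬ Dominates w P Q) :
    ∑ x, (w x : EReal) * infoDiv (fun r => P r x) (fun r => Q r x) = ⊤ := by
  simp only [Dominates, not_forall] at hdom
  obtain ⟨x, r, hwp, hq⟩ := hdom
  rw [not_not] at hq
  have hinfo : ∀ y, 0 ≤ infoDiv (fun r => P r y) (fun r => Q r y) := fun y => by
    unfold infoDiv
    split_ifs with hac
    · exact EReal.coe_nonneg.2
        (Finset.sum_nonneg fun r _ => klTerm_nonneg (hP r y) (hQ r y) (hac r))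
    · exact le_top
  have htop : (w x : EReal) * infoDiv (fun r => P r x) (fun r => Q r x) = ⊤ := by
    rw [infoDiv, if_neg fun hac => right_ne_zero_of_mul hwp (hac r hq)]
    exact EReal.coe_mul_top_of_pos ((hw x).lt_of_ne' (left_ne_zero_of_mul hwp))
  rw [eq_top_iff, ← htop]
  exact Finset.single_le_sum
    (f := fun y => (w y : EReal) * infoDiv (fun r => P r y) (fun r => Q r y))
    (fun y _ => EReal.mul_nonneg (EReal.coe_nonneg.2 (hw y)) (hinfo y)) (Finset.mem_univ x)

/-- The dual variable `λ(r, x) + β + α·r·1(x = x')` collected into one matrix. -/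
noncomputable def slackMat (v : R → ℝ) (x' : X) (α β : ℝ) (l : RMat R X) : RMat R X :=
  fun r x => l r x + β + α * v r * (if x = x' then 1 else 0)

lemma pairing_slackMat (v : R → ℝ) (x' : X) (α β : ℝ) (l Q : RMat R X) :
    pairing (slackMat v x' α β l) Q =
      pairing l Q + β * (∑ x, ∑ r, Q r x) + α * rewOf v Q x' := by
  have hind : ∑ x, ∑ r, α * v r * (if x = x' then 1 else 0) * Q r x = α * rewOf v Q x' := by
    rw [Finset.sum_eq_single x' (by intro x _ hx; simp [hx]) (by simp)]
    simp [rewOf, Finset.mul_sum, mul_assoc]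
  rw [← hind]
  simp only [pairing_apply, slackMat, add_mul, Finset.sum_add_distrib, Finset.mul_sum]

lemma sum_mul_elog_le {w : X → ℝ} (hw : ∀ x, 0 ≤ w x) {P Q s : RMat R X}
    (hP : ∀ r x, 0 ≤ P r x) (hQ : ∀ r x, 0 ≤ Q r x) (hdom : Dominates w P Q)
    (hs : ∀ x r, 0 ≤ w x - s r x) :
    ∑ x, ∑ r, ((w x * P r x : ℝ) : EReal) * elog ((w x - s r x) / w x) ≤
      ((weightedDiv w P Q - pairing s Q : ℝ) : EReal) := by
  have hsum : weightedDiv w P Q - pairing s Q =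
      ∑ x, ∑ r, (w x * klTerm (P r x) (Q r x) - (w x - (w x - s r x)) * Q r x) := by
    simp [weightedDiv, pairing_apply, Finset.mul_sum, Finset.sum_sub_distrib]
  simp only [hsum, coe_finsetSum]
  exact Finset.sum_le_sum fun x _ => Finset.sum_le_sum fun r _ =>
    mul_elog_le (hw x) (hP r x) (hQ r x) (hs x r) (hdom x r)

/-- At `s = divGrad w P Q` the logarithmic part of the dual matches the primal objective. -/
lemma sum_mul_elog_divGrad {w : X → ℝ} (hw : ∀ x, 0 ≤ w x) {P Q : RMat R X}
    (hP : ∀ r x, 0 ≤ P r x) (hQ : ∀ r x, 0 ≤ Q r x) (hdom : Dominates w P Q) :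
    ∑ x, ∑ r, ((w x * P r x : ℝ) : EReal) * elog ((w x - divGrad w P Q r x) / w x) =
      ((weightedDiv w P Q - pairing (divGrad w P Q) Q : ℝ) : EReal) := by
  have hsum : weightedDiv w P Q - pairing (divGrad w P Q) Q =
      ∑ x, ∑ r, (w x * klTerm (P r x) (Q r x) - divGrad w P Q r x * Q r x) := by
    simp [weightedDiv, pairing_apply, Finset.mul_sum, Finset.sum_sub_distrib]
  simp only [hsum, coe_finsetSum]
  refine Finset.sum_congr rfl fun x _ => Finset.sum_congr rfl fun r _ => ?_
  by_cases hwp : w x * P r x = 0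
  · rcases mul_eq_zero.1 hwp with h0 | h0 <;> simp [h0, divGrad, klTerm]
  have hw' := (hw x).lt_of_ne' (left_ne_zero_of_mul hwp)
  have hp' := (hP r x).lt_of_ne' (right_ne_zero_of_mul hwp)
  have hq' := (hQ r x).lt_of_ne' (hdom x r hwp)
  have harg : (w x - divGrad w P Q r x) / w x = P r x / Q r x := by
    unfold divGrad; field_simp; ring
  rw [harg, elog, if_pos (div_pos hp' hq'), ← EReal.coe_mul, EReal.coe_eq_coe_iff]
  unfold divGrad klTerm
  field_simp
  ring

lemma sum_sum_of_mem_POmega {Q : RMat R X} (hQ : Q ∈ POmega) :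
    ∑ x, ∑ r, Q r x = (Fintype.card X : ℝ) := by
  simp [hQ.2]

lemma mem_dualConeP_iff {PP : Set (RMat R X)} (l : RMat R X) :
    l ∈ dualConeP PP ↔ ∀ Q ∈ PP, 0 ≤ pairing l Q := by
  constructor
  · exact fun h Q hQ => h Q ⟨1, zero_le_one, Q, hQ, (one_smul ℝ Q).symm⟩
  · rintro h _ ⟨θ, hθ, Q, hQ, rfl⟩
    rw [← pairing_apply, map_smul]
    exact mul_nonneg hθ (h Q hQ)

lemma rewOf_eq_pairing (v : R → ℝ) (x' : X) (Q : RMat R X) :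
    rewOf v Q x' = pairing (slackMat v x' 1 0 0) Q := by
  have h0 : pairing (0 : RMat R X) Q = 0 := by simp [pairing_apply]
  rw [pairing_slackMat, h0]
  ring

variable [Nonempty X]

/-- The weight of each arm: `γ` on optimal arms and `η` on suboptimal ones. -/
noncomputable def armWeight (v : R → ℝ) (γ : ℝ) (η : X → ℝ) (P : RMat R X) (x : X) : ℝ :=
  if rewOf v P x = rewStar v P then γ else η x

lemma sum_sub_add_sum_opt {M : Type*} [AddCommMonoid M] (v : R → ℝ) (P : RMat R X)
    (f g h : X → M) (hf : ∀ x ∈ subFinset v P, h x = f x)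
    (hg : ∀ x ∈ optFinset v P, h x = g x) :
    ∑ x ∈ subFinset v P, f x + ∑ x ∈ optFinset v P, g x = ∑ x, h x := by
  rw [← Finset.sum_congr rfl hf, ← Finset.sum_congr rfl hg, add_comm]
  exact Finset.sum_filter_add_sum_filter_not _ _ _

lemma armWeight_of_mem_sub {v : R → ℝ} {γ : ℝ} {η : X → ℝ} {P : RMat R X} {x : X}
    (hx : x ∈ subFinset v P) : armWeight v γ η P x = η x :=
  if_neg (Finset.mem_filter.1 hx).2

lemma armWeight_of_mem_opt {v : R → ℝ} {γ : ℝ} {η : X → ℝ} {P : RMat R X} {x : X}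
    (hx : x ∈ optFinset v P) : armWeight v γ η P x = γ :=
  if_pos (Finset.mem_filter.1 hx).2

lemma distObjPert_eq (v : R → ℝ) (γ : ℝ) (η : X → ℝ) (P Q : RMat R X) :
    distObjPert v γ η P Q =
      ∑ x, (armWeight v γ η P x : EReal) * infoDiv (fun r => P r x) (fun r => Q r x) :=
  sum_sub_add_sum_opt v P _ _ _ (fun x hx => by rw [armWeight_of_mem_sub hx])
    (fun x hx => by rw [armWeight_of_mem_opt hx])

lemma dualFnPert_eq (v : R → ℝ) (γ : ℝ) (η : X → ℝ) {x' : X} (P : RMat R X) (α β : ℝ)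
    (l : RMat R X) (hx' : x' ∈ subFinset v P) :
    dualFnPert v γ η x' P α β l =
      if ∀ x r, 0 ≤ armWeight v γ η P x - slackMat v x' α β l r x then
        (∑ x, ∑ r, ((armWeight v γ η P x * P r x : ℝ) : EReal) *
          elog ((armWeight v γ η P x - slackMat v x' α β l r x) / armWeight v γ η P x)) +
        ((α * rewStar v P + β * (Fintype.card X : ℝ) : ℝ) : EReal)
      else ⊥ := by
  have hs : ∀ x ∈ subFinset v P, ∀ r, armWeight v γ η P x - slackMat v x' α β l r x =
      η x - l r x - β - α * v r * (if x = x' then 1 else 0) := fun x hx r => by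
    rw [armWeight_of_mem_sub hx, slackMat]; ring
  have ho : ∀ x ∈ optFinset v P, ∀ r, armWeight v γ η P x - slackMat v x' α β l r x =
      γ - l r x - β := fun x hx r => by
    have hne : x ≠ x' := by
      rintro rfl
      exact (Finset.mem_filter.1 hx').2 (Finset.mem_filter.1 hx).2
    rw [armWeight_of_mem_opt hx, slackMat, if_neg hne]; ring
  unfold dualFnPert
  refine if_congr ?_ ?_ rfl
  · constructor
    · rintro ⟨h1, h2⟩ x r
      by_cases hx : rewOf v P x = rewStar v P
      · have hx : x ∈ optFinset v P := Finset.mem_filter.2 ⟨Finset.mem_univ _, hx⟩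
        rw [ho x hx]; exact h2 x hx r
      · have hx : x ∈ subFinset v P := Finset.mem_filter.2 ⟨Finset.mem_univ _, hx⟩
        rw [hs x hx]; exact h1 x hx r
    · exact fun h => ⟨fun x hx r => hs x hx r ▸ h x r, fun x hx r => ho x hx r ▸ h x r⟩
  · congr 1
    refine sum_sub_add_sum_opt v P _ _ _ (fun x hx => ?_) (fun x hx => ?_)
    · refine Finset.sum_congr rfl fun r _ => ?_
      rw [hs x hx, armWeight_of_mem_sub hx]
    · refine Finset.sum_congr rfl fun r _ => ?_
      rw [ho x hx, armWeight_of_mem_opt hx]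

/-- Normalising the cone `𝒦` by the total mass `|X|` recovers `𝒫`. -/
lemma mem_coneP_and_sum_eq_card_iff {PP : Set (RMat R X)} (hsub : PP ⊆ POmega) (Q : RMat R X) :
    (Q ∈ coneP PP ∧ ∑ x, ∑ r, Q r x = (Fintype.card X : ℝ)) ↔ Q ∈ PP := by
  constructor
  · rintro ⟨⟨θ, -, Q', hQ', rfl⟩, hsum⟩
    have hθ : θ * (Fintype.card X : ℝ) = Fintype.card X := by
      rw [← sum_sum_of_mem_POmega (hsub hQ')] at hsum ⊢
      simpa [Finset.mul_sum] using hsum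
    have hcard : (Fintype.card X : ℝ) ≠ 0 := by simp
    rw [mul_eq_right₀ hcard] at hθ
    simpa [hθ] using hQ'
  · exact fun hQ => ⟨⟨1, zero_le_one, Q, hQ, (one_smul ℝ Q).symm⟩,
      sum_sum_of_mem_POmega (hsub hQ)⟩

/-- For a deceitful arm the primal problem has a strictly feasible point. -/
lemma exists_rewStar_lt_rewOf {v : R → ℝ} {PP : Set (RMat R X)} {P : RMat R X} (hP : P ∈ PP)
    {x' : X} (hx' : x' ∈ deceitArms v PP P) : ∃ Q ∈ PP, rewStar v P < rewOf v Q x' := by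
  have hlt := hx'.2
  unfold rewMax at hlt
  obtain ⟨_, ⟨Q, hQ, -, rfl⟩, hlt⟩ :=
    exists_lt_of_lt_csSup (by exact ⟨_, P, hP, fun _ _ _ => rfl, rfl⟩) hlt
  exact ⟨Q, hQ, hlt⟩

/-- Weak duality. -/
lemma dualFnPert_le_distObjPert {v : R → ℝ} {PP : Set (RMat R X)} (hsub : PP ⊆ POmega)
    {γ : ℝ} (hγ : 0 ≤ γ) {P : RMat R X} (hP : P ∈ PP) {x' : X} (hx' : x' ∈ subFinset v P)
    {η : X → ℝ} (hη : ∀ x, 0 ≤ η x) {α β : ℝ} {l : RMat R X} (hα : 0 ≤ α)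
    (hl : l ∈ dualConeP PP) {Q : RMat R X} (hQ : Q ∈ PP) (hrew : rewStar v P ≤ rewOf v Q x') :
    dualFnPert v γ η x' P α β l ≤ distObjPert v γ η P Q := by
  have hw : ∀ x, 0 ≤ armWeight v γ η P x := fun x => by
    unfold armWeight; split_ifs <;> simp [hγ, hη]
  rw [distObjPert_eq, dualFnPert_eq _ _ _ _ _ _ _ hx']
  split_ifs with hs
  swap; · exact bot_le
  by_cases hdom : Dominates (armWeight v γ η P) P Q
  swap
  · rw [sum_mul_infoDiv_of_not_dominates hw (hsub hP).1 (hsub hQ).1 hdom]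
    exact le_top
  rw [sum_mul_infoDiv_of_dominates hdom]
  refine (add_le_add_left (sum_mul_elog_le hw (hsub hP).1 (hsub hQ).1 hdom hs) _).trans ?_
  rw [← EReal.coe_add, EReal.coe_le_coe_iff, pairing_slackMat, sum_sum_of_mem_POmega (hsub hQ)]
  nlinarith [(mem_dualConeP_iff l).1 hl Q hQ, mul_le_mul_of_nonneg_left hrew hα]

/-- The optimal primal value is attained, and equals the dual value at some multiplier. -/
lemma exists_distObjPert_eq_dualFnPert {v : R → ℝ} {PP : Set (RMat R X)} (hsub : PP ⊆ POmega)
    (hconv : Convex ℝ PP) (hcomp : IsCompact PP) {γ : ℝ} (hγ : 0 ≤ γ) {P : RMat R X}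
    (hP : P ∈ PP) {x' : X} (hx' : x' ∈ deceitArms v PP P) {η : X → ℝ} (hη : ∀ x, 0 ≤ η x) :
    ∃ Q ∈ PP, rewStar v P ≤ rewOf v Q x' ∧ ∃ (α β : ℝ) (l : RMat R X), 0 ≤ α ∧
      l ∈ dualConeP PP ∧ distObjPert v γ η P Q = dualFnPert v γ η x' P α β l := by
  set w := armWeight v γ η P with hwdef
  have hw : ∀ x, 0 ≤ w x := fun x => by
    simp only [hwdef, armWeight]; split_ifs <;> simp [hγ, hη]
  have hP₀ := (hsub hP).1
  have hx's : x' ∈ subFinset v P := Finset.mem_filter.2 ⟨Finset.mem_univ _, hx'.1⟩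
  set e : RMat R X := slackMat v x' 1 0 0 with he
  simp only [rewOf_eq_pairing v x'] at *
  set S : Set (RMat R X) := PP ∩ {Q | rewStar v P ≤ pairing e Q} with hS
  have hScomp : IsCompact S := hcomp.inter_right
    (isClosed_le continuous_const (pairing e).continuous_of_finiteDimensional)
  have hSconv : Convex ℝ S :=
    hconv.inter (convex_halfSpace_ge (pairing e).isLinear _)
  have hS₀ : ∀ Q ∈ S, ∀ r x, 0 ≤ Q r x := fun Q hQ => (hsub hQ.1).1
  obtain ⟨Q₁, hQ₁, hslater⟩ := exists_rewStar_lt_rewOf hP hx'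
  rw [rewOf_eq_pairing, ← he] at hslater
  obtain ⟨Q₀, hQ₀, hdom₀⟩ : ∃ Q₀ ∈ S, Dominates w P Q₀ := by
    have hcont : ContinuousAt
        (fun t : ℝ => (1 - t) * pairing e Q₁ + t * pairing e P) 0 := by fun_prop
    have hev := hcont.eventually (lt_mem_nhds (by simpa using hslater))
    obtain ⟨t, ht, ht0, ht1⟩ := ((hev.filter_mono nhdsWithin_le_nhds).and
      (Ioo_mem_nhdsGT (zero_lt_one' ℝ))).exists
    refine ⟨(1 - t) • Q₁ + t • P, ⟨hconv hQ₁ hP (by linarith) ht0.le (by ring), ?_⟩, ?_⟩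
    · simpa using ht.le
    · intro x r hwp
      have hp := (hP₀ r x).lt_of_ne' (right_ne_zero_of_mul hwp)
      have hq := (hsub hQ₁).1 r x
      have hpos : 0 < (1 - t) * Q₁ r x + t * P r x :=
        add_pos_of_nonneg_of_pos (mul_nonneg (by linarith) hq) (mul_pos ht0 hp)
      simpa using hpos.ne'
  obtain ⟨Q', hQ', hdom, hmin⟩ := exists_isMin_weightedDiv hScomp hS₀ hw hP₀ hQ₀ hdom₀
  set g := divGrad w P Q' with hg
  have hfirst : ∀ Q ∈ S, pairing g Q' ≤ pairing g Q := fun Q hQ =>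
    pairing_divGrad_le_of_isMin hSconv hS₀ hw hP₀ hQ' hdom hmin hQ
  obtain ⟨α, hα, hlag⟩ := exists_lagrange_multiplier
    (G := fun Q => pairing g Q - pairing g Q') (H := fun Q => pairing e Q - rewStar v P)
    (((pairing g).convexOn hconv).sub (concaveOn_const _ hconv))
    (((pairing e).concaveOn hconv).sub (convexOn_const _ hconv))
    (fun Q hQ h => sub_nonneg.2 (hfirst Q ⟨hQ, sub_nonneg.1 h⟩)) hQ₁ (sub_pos.2 hslater)
  have hcard : (Fintype.card X : ℝ) ≠ 0 := by simp
  set β : ℝ := (pairing g Q' - α * rewStar v P) / Fintype.card X with hβ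
  have hβcard : β * Fintype.card X = pairing g Q' - α * rewStar v P := by
    rw [hβ, div_mul_cancel₀ _ hcard]
  set l : RMat R X := fun r x => g r x - β - α * v r * (if x = x' then 1 else 0) with hl
  have hslack : slackMat v x' α β l = g := by
    funext r x; simp only [slackMat, hl]; ring
  refine ⟨Q', hQ'.1, hQ'.2, α, β, l, hα, (mem_dualConeP_iff l).2 fun Q hQ => ?_, ?_⟩
  · have hpair := pairing_slackMat v x' α β l Q
    rw [hslack, sum_sum_of_mem_POmega (hsub hQ), rewOf_eq_pairing, ← he] at hpair
    have := hlag Q hQ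
    linarith
  · have hnonneg : ∀ x r, 0 ≤ w x - g r x := fun x r => by
      have : w x - g r x = w x * P r x / Q' r x := by simp [hg, divGrad]
      rw [this]
      exact div_nonneg (mul_nonneg (hw x) (hP₀ r x)) (hS₀ Q' hQ' r x)
    rw [distObjPert_eq, dualFnPert_eq _ _ _ _ _ _ _ hx's, hslack, if_pos hnonneg,
      sum_mul_infoDiv_of_dominates hdom, sum_mul_elog_divGrad hw hP₀ (hS₀ Q' hQ') hdom,
      ← EReal.coe_add, EReal.coe_eq_coe_iff, hβcard]
    ring

end Duality

/-- strong duality for the perturbed distance function: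
for every `γ ≥ 0`, `P ∈ 𝒫` and deceitful arm `x' ∈ X̃_d(P)`,
`Dist_γ(η, x', P) = sup { Dual_γ(η, x', P; μ) : μ = (α,β,λ) ∈ ℝ₊ × ℝ × 𝒦* }`. -/
theorem perturbed_strong_duality
    (v : R → ℝ) (hv : ∀ r, 0 ≤ v r)
    (PP : Set (RMat R X)) (hsub : PP ⊆ POmega) (hconv : Convex ℝ PP)
    (hcomp : IsCompact PP) (hne : (relIntIn POmega PP).Nonempty)
    (γ : ℝ) (hγ : 0 ≤ γ)
    (P : RMat R X) (hP : P ∈ PP)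
    (x' : X) (hx' : x' ∈ deceitArms v PP P)
    (η : X → ℝ) (hη : ∀ x, 0 ≤ η x) :
    DistPert v PP γ η x' P =
      sSup {d : EReal | ∃ (α β : ℝ) (l : RMat R X),
        0 ≤ α ∧ l ∈ dualConeP PP ∧ d = dualFnPert v γ η x' P α β l} := by
  have hx's : x' ∈ subFinset v P := Finset.mem_filter.2 ⟨Finset.mem_univ _, hx'.1⟩
  have hfeas : ∀ Q : RMat R X, (Q ∈ coneP PP ∧ ∑ x, ∑ r, Q r x = (Fintype.card X : ℝ) ∧
      rewStar v P ≤ rewOf v Q x') ↔ Q ∈ PP ∧ rewStar v P ≤ rewOf v Q x' := fun Q => by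
    rw [← and_assoc, mem_coneP_and_sum_eq_card_iff hsub]
  unfold DistPert
  simp only [hfeas]
  apply le_antisymm
  · obtain ⟨Q, hQ, hrew, α, β, l, hα, hl, heq⟩ :=
      exists_distObjPert_eq_dualFnPert hsub hconv hcomp hγ hP hx' hη
    exact le_trans (sInf_le ⟨Q, ⟨hQ, hrew⟩, heq⟩) (le_sSup ⟨α, β, l, hα, hl, rfl⟩)
  · refine sSup_le ?_
    rintro _ ⟨α, β, l, hα, hl, rfl⟩
    refine le_sInf ?_
    rintro _ ⟨Q, ⟨hQ, hrew⟩, rfl⟩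
    exact dualFnPert_le_distObjPert hsub hγ hP hx's hη hα hl hQ hrew

end Bandit
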